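/- arXiv:1603.06870 — 6 statements merged into one kernel-verified Lean document; each statement's English description precedes it below -/
import Mathlib

section
/- Payment–accuracy bounds (Theorem 3): Assume the set argmax_{ε>0} D(ε)/V_LB(ε) is nonempty and has a least element ε̃, and for τ ∈ (0,1) let Ñ = ⌈ln(1/τ)/D(ε̃)⌉. Let F(τ) be the infimum, over N ∈ ℕ, privacy parameters ε_1,…,ε_N ∈ (ℝ∖{0}) ∪ {⊥}, and nonnegative payment mechanisms R : X^N → ℝ^N in which the strategy profile (σ^{(ε_1)},…,σ^{(ε_N)}) is a Nash equilibrium (where σ^{(⊥)} denotes a non-informative strategy), of the total expected payment Σ_{i=1}^N E[R_i(X)], subject to e^{−Σ_{i=1}^N D(ε_i)} ≤ τ. Then for every τ ∈ (0,1), F(τ) ≥ (Ñ−1)·V_LB(ε̃), and there exist constants C > 0 and τ₀ ∈ (0,1) such that for all τ ∈ (0, τ₀), F(τ) ≤ Ñ·V_LB(ε̃) + C·τ·ln(1/τ). -/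
open Real

/-- The set of possible reports: `some b` is report `b ∈ {0,1}`, `none` is nonparticipation `⊥`. -/
abbrev Report := Option Bool

/-- A (behavioral) strategy: a conditional distribution of the report given the signal. -/
def IsStrategy (σ : Bool → Report → ℝ) : Prop :=
  (∀ s x, 0 ≤ σ s x) ∧ ∀ s, ∑ x : Report, σ s x = 1

/-- `P_σ(X ∈ E | S = s)`. -/
def probE (σ : Bool → Report → ℝ) (E : Finset Report) (s : Bool) : ℝ :=
  ∑ x ∈ E, σ s x

/-- One log-likelihood-ratio term `ln(a/b)`, with the convention `0/0 = 1`,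
clamped into `[0,∞]` (this does not change the supremum defining the privacy level,
since the supremum is always ≥ 0). -/
noncomputable def llr (a b : ℝ) : ENNReal :=
  if a = 0 ∧ b = 0 then 0
  else if b = 0 then ⊤
  else ENNReal.ofReal (Real.log (a / b))

/-- The (local) differential privacy level `ζ(σ)` of a strategy, valued in `[0,∞]`. -/
noncomputable def privLevel (σ : Bool → Report → ℝ) : ENNReal :=
  ⨆ (E : Finset Report), ⨆ (s : Bool), llr (probE σ E s) (probE σ E (!s))

/-- The privacy cost `g(ζ(σ))`, valued in extended reals (at `ζ = ∞` we take the
supremum extension of `g`). -/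
noncomputable def privCost (g : ℝ → ℝ) (σ : Bool → Report → ℝ) : EReal :=
  if privLevel σ = ⊤ then ⨆ x ∈ Set.Ici (0:ℝ), ((g x : ℝ) : EReal)
  else ((g (privLevel σ).toReal : ℝ) : EReal)

/-- `P(S_i = s | W = w) = θ` if `s = w`, else `1 - θ`. -/
def signalProb (θ : ℝ) (w s : Bool) : ℝ := if s = w then θ else 1 - θ

/-- Joint probability of state `w`, signals `s` and reports `x`, where `p = P_W(1)`. -/
def jointProb {N : ℕ} (p θ : ℝ) (σ : Fin N → Bool → Report → ℝ)
    (w : Bool) (s : Fin N → Bool) (x : Fin N → Report) : ℝ :=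
  (if w then p else 1 - p) * ∏ i, (signalProb θ w (s i) * σ i (s i) (x i))

/-- Expected payment `E_σ[R_i(X)]` to individual `i`. -/
noncomputable def expPay {N : ℕ} (p θ : ℝ) (σ : Fin N → Bool → Report → ℝ)
    (R : (Fin N → Report) → Fin N → ℝ) (i : Fin N) : ℝ :=
  ∑ w : Bool, ∑ s : Fin N → Bool, ∑ x : Fin N → Report,
    jointProb p θ σ w s x * R x i

/-- Expected utility of individual `i`: expected payment minus privacy cost. -/
noncomputable def utility {N : ℕ} (p θ : ℝ) (g : ℝ → ℝ)
    (σ : Fin N → Bool → Report → ℝ)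
    (R : (Fin N → Report) → Fin N → ℝ) (i : Fin N) : EReal :=
  ((expPay p θ σ R i : ℝ) : EReal) - privCost g (σ i)

/-- `σ` is a Nash equilibrium of the payment mechanism `R`. -/
def NashEq {N : ℕ} (p θ : ℝ) (g : ℝ → ℝ)
    (σ : Fin N → Bool → Report → ℝ)
    (R : (Fin N → Report) → Fin N → ℝ) : Prop :=
  (∀ i, IsStrategy (σ i)) ∧
  ∀ (i : Fin N) (σ' : Bool → Report → ℝ), IsStrategy σ' →
    utility p θ g (Function.update σ i σ') R i ≤ utility p θ g σ R i

/-- The `ε`-strategy: symmetric randomized response flipping with prob. `1/(e^ε+1)`. -/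
noncomputable def epsStrategy (ε : ℝ) : Bool → Report → ℝ :=
  fun s x => match x with
  | none => 0
  | some b => if b = s then Real.exp ε / (Real.exp ε + 1) else 1 / (Real.exp ε + 1)

/-- The lower bound `V_LB(ε)` on the value of `ε` units of privacy. -/
noncomputable def VLB (θ : ℝ) (g' : ℝ → ℝ) (ε : ℝ) : ℝ :=
  g' ε * ((Real.exp ε + 1) / Real.exp ε) *
    ((θ / (2 * θ - 1)) * (Real.exp ε + 1) - 1)

/-- The hypotheses on the privacy cost function `g` (with derivative `g'`):
proper (nonnegative, `g(0) = 0`, non-decreasing), convex, continuously differentiable,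
and vanishing only at `0`. -/
structure ProperCost (g g' : ℝ → ℝ) : Prop where
  conv : ConvexOn ℝ (Set.Ici 0) g
  deriv : ∀ x ∈ Set.Ici (0:ℝ), HasDerivAt g (g' x) x
  derivCont : ContinuousOn g' (Set.Ici 0)
  mono : MonotoneOn g (Set.Ici 0)
  nonneg : ∀ x ∈ Set.Ici (0:ℝ), 0 ≤ g x
  zero : g 0 = 0
  pos : ∀ x > (0:ℝ), 0 < g x


/-- `σ` is non-informative: the report is independent of the signal. -/
def NonInformative (σ : Bool → Report → ℝ) : Prop :=
  ∀ x : Report, σ true x = σ false x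

/-- The per-individual Chernoff information `D(ε)` for a positive privacy level `ε`. -/
noncomputable def dExp (θ ε : ℝ) : ℝ :=
  (1/2) * Real.log ((Real.exp ε + 1)^2 /
    (4 * (θ * Real.exp ε + 1 - θ) * ((1 - θ) * Real.exp ε + θ)))

/-- Chernoff information of an individual's privacy parameter in `(ℝ∖{0}) ∪ {⊥}`:
`D(⊥) = 0` and `D(ε) = dExp θ |ε|` for `ε ≠ 0`. -/
noncomputable def DOpt (θ : ℝ) : Option ℝ → ℝ
  | none => 0
  | some ε => dExp θ |ε|

/-- The minimum total payment `F(τ)` of the payment–accuracy problem: the infimum over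
the number of individuals `N`, privacy parameters `e_i ∈ (ℝ∖{0}) ∪ {⊥}`, and nonnegative
payment mechanisms `R` in which the profile `(σ^{(e_1)},…,σ^{(e_N)})` (where `σ^{(⊥)}`
is a non-informative strategy) is a Nash equilibrium, of the total expected payment,
subject to the accuracy constraint `e^{−Σ_i D(e_i)} ≤ τ`. -/
noncomputable def Fpay (p θ : ℝ) (g : ℝ → ℝ) (τ : ℝ) : ℝ :=
  sInf {t : ℝ | ∃ (N : ℕ) (e : Fin N → Option ℝ)
      (σ : Fin N → Bool → Report → ℝ) (R : (Fin N → Report) → Fin N → ℝ),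
      (∀ x i, 0 ≤ R x i) ∧
      (∀ i : Fin N, match e i with
        | some ei => ei ≠ 0 ∧ σ i = epsStrategy ei
        | none => IsStrategy (σ i) ∧ NonInformative (σ i)) ∧
      NashEq p θ g σ R ∧
      Real.exp (-(∑ i : Fin N, DOpt θ (e i))) ≤ τ ∧
      t = ∑ i : Fin N, expPay p θ σ R i}

/-! ### Convexity -/

lemma ConvexOn.tangent_le {S : Set ℝ} {f : ℝ → ℝ} {f' x y : ℝ} (hf : ConvexOn ℝ S f)
    (hx : x ∈ S) (hy : y ∈ S) (hd : HasDerivAt f f' x) : f x + f' * (y - x) ≤ f y := by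
  rcases lt_trichotomy x y with h | rfl | h
  · have := hf.le_slope_of_hasDerivAt hx hy h hd
    rw [slope_def_field, le_div_iff₀ (sub_pos.2 h)] at this
    linarith
  · simp
  · have := hf.slope_le_of_hasDerivAt hy hx h hd
    rw [slope_def_field, div_le_iff₀ (sub_pos.2 h)] at this
    linarith

lemma concaveOn_sigmoid : ConcaveOn ℝ (Set.Ici 0) sigmoid := by
  refine AntitoneOn.concaveOn_of_deriv (convex_Ici 0) continuous_sigmoid.continuousOn
    differentiable_sigmoid.differentiableOn ?_
  intro x hx y hy hxy
  rw [interior_Ici, Set.mem_Ioi] at hx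
  have h1 := sigmoid_le hxy
  have h2 := sigmoid_le hx.le
  rw [sigmoid_zero] at h2
  simp only [deriv_sigmoid]
  nlinarith

lemma sigmoid_tangent_ge {x y : ℝ} (hx : 0 ≤ x) (hy : 0 ≤ y) :
    sigmoid y ≤ sigmoid x + sigmoid x * (1 - sigmoid x) * (y - x) := by
  have := concaveOn_sigmoid.neg.tangent_le hx hy (hasDerivAt_sigmoid x).neg
  simp only [Pi.neg_apply] at this
  linarith

lemma exp_div_exp_add_one (x : ℝ) : exp x / (exp x + 1) = sigmoid x := by
  rw [sigmoid_def, exp_neg]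
  have := exp_pos x
  field_simp

lemma one_div_exp_add_one (x : ℝ) : 1 / (exp x + 1) = 1 - sigmoid x := by
  rw [← exp_div_exp_add_one]
  have := exp_pos x
  field_simp
  ring

lemma half_lt_sigmoid {x : ℝ} (hx : 0 < x) : 1 / 2 < sigmoid x := by
  have := sigmoid_lt hx
  rw [sigmoid_zero] at this
  linarith

lemma one_sub_sigmoid_mul_exp (x : ℝ) : (1 - sigmoid x) * exp x = sigmoid x := by
  rw [← one_div_exp_add_one, ← exp_div_exp_add_one]
  ring

namespace ProperCost

variable {g g' : ℝ → ℝ}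

lemma tangent_le (hg : ProperCost g g') {x y : ℝ} (hx : 0 ≤ x) (hy : 0 ≤ y) :
    g x + g' x * (y - x) ≤ g y :=
  hg.conv.tangent_le hx hy (hg.deriv x hx)

lemma deriv_pos (hg : ProperCost g g') {x : ℝ} (hx : 0 < x) : 0 < g' x := by
  have h1 := hg.tangent_le hx.le le_rfl
  have h2 := hg.pos x hx
  rw [hg.zero] at h1
  by_contra! h
  nlinarith

lemma iSup_eq_top (hg : ProperCost g g') :
    (⨆ x ∈ Set.Ici (0 : ℝ), ((g x : ℝ) : EReal)) = ⊤ := by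
  rw [EReal.eq_top_iff_forall_lt]
  intro y
  have h1 := hg.deriv_pos one_pos
  have h2 := hg.pos 1 one_pos
  set z := 1 + |y| / g' 1
  have hz : 0 ≤ z := by positivity
  have h3 := hg.tangent_le zero_le_one hz
  have h4 : g' 1 * (z - 1) = |y| := by
    simp only [z]
    field_simp
    ring
  have h5 : y < g z := by linarith [le_abs_self y]
  exact lt_of_lt_of_le (EReal.coe_lt_coe_iff.2 h5)
    (le_iSup₂ (f := fun x (_ : x ∈ Set.Ici (0 : ℝ)) => ((g x : ℝ) : EReal)) z hz)

end ProperCost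

/-! ### Privacy levels -/

lemma llr_le_ofReal {a b c : ℝ} (ha : 0 ≤ a) (hb : 0 ≤ b) (hc : 0 ≤ c) (h : a ≤ exp c * b) :
    llr a b ≤ ENNReal.ofReal c := by
  unfold llr
  split_ifs with h1 h2
  · exact zero_le
  · subst h2
    exact absurd ⟨le_antisymm (by simpa using h) ha, rfl⟩ h1
  · refine ENNReal.ofReal_le_ofReal ?_
    have hb' : 0 < b := lt_of_le_of_ne hb (Ne.symm h2)
    rcases ha.eq_or_lt with rfl | ha'
    · simpa using hc
    · rw [log_le_iff_le_exp (div_pos ha' hb'), div_le_iff₀ hb']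
      exact h

lemma le_of_llr_le_ofReal {a b c : ℝ} (hb : 0 ≤ b) (hc : 0 ≤ c)
    (h : llr a b ≤ ENNReal.ofReal c) : a ≤ exp c * b := by
  unfold llr at h
  split_ifs at h with h1 h2
  · simp [h1.1, h1.2]
  · simp at h
  · have hb' : 0 < b := lt_of_le_of_ne hb (Ne.symm h2)
    rcases le_or_gt a 0 with ha | ha
    · exact ha.trans (by positivity)
    · rw [ENNReal.ofReal_le_ofReal_iff hc, log_le_iff_le_exp (div_pos ha hb'),
        div_le_iff₀ hb'] at h
      exact h

lemma privLevel_le_ofReal {σ : Bool → Report → ℝ} (hσ : ∀ s x, 0 ≤ σ s x) {c : ℝ} (hc : 0 ≤ c)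
    (h : ∀ s x, σ s x ≤ exp c * σ (!s) x) : privLevel σ ≤ ENNReal.ofReal c := by
  refine iSup₂_le fun E s => llr_le_ofReal (Finset.sum_nonneg fun x _ => hσ _ _)
    (Finset.sum_nonneg fun x _ => hσ _ _) hc ?_
  unfold probE
  rw [Finset.mul_sum]
  exact Finset.sum_le_sum fun x _ => h s x

lemma le_of_privLevel_le_ofReal {σ : Bool → Report → ℝ} (hσ : ∀ s x, 0 ≤ σ s x) {c : ℝ}
    (hc : 0 ≤ c) (h : privLevel σ ≤ ENNReal.ofReal c) (s : Bool) (x : Report) :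
    σ s x ≤ exp c * σ (!s) x := by
  have := (le_iSup₂ (f := fun (E : Finset Report) s => llr (probE σ E s) (probE σ E (!s)))
    {x} s).trans h
  simp only [probE, Finset.sum_singleton] at this
  exact le_of_llr_le_ofReal (hσ _ _) hc this

lemma epsStrategy_some (ε : ℝ) (s b : Bool) :
    epsStrategy ε s (some b) = if b = s then sigmoid ε else 1 - sigmoid ε := by
  simp only [epsStrategy, exp_div_exp_add_one, one_div_exp_add_one]

@[simp] lemma epsStrategy_none (ε : ℝ) (s : Bool) : epsStrategy ε s none = 0 := rfl

lemma isStrategy_epsStrategy (ε : ℝ) : IsStrategy (epsStrategy ε) := by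
  have h0 := sigmoid_nonneg ε
  have h1 := sigmoid_le_one ε
  refine ⟨fun s x => ?_, fun s => ?_⟩
  · rcases x with _ | b
    · simp
    · rw [epsStrategy_some]
      split_ifs <;> linarith
  · cases s <;> simp [Fintype.sum_option, epsStrategy_some]

lemma privLevel_epsStrategy (ε : ℝ) : privLevel (epsStrategy ε) = ENNReal.ofReal |ε| := by
  have h0 := sigmoid_pos ε
  have h1 := sigmoid_lt_one ε
  have hs := (isStrategy_epsStrategy ε).1
  have hm := one_sub_sigmoid_mul_exp ε
  have hm' := one_sub_sigmoid_mul_exp (-ε)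
  rw [sigmoid_neg, sub_sub_cancel] at hm'
  have hle : privLevel (epsStrategy ε) ≤ ENNReal.ofReal |ε| := by
    refine privLevel_le_ofReal hs (abs_nonneg _) fun s x => ?_
    have hp : exp ε ≤ exp |ε| := exp_le_exp.2 (le_abs_self ε)
    have hn : exp (-ε) ≤ exp |ε| := exp_le_exp.2 (neg_le_abs ε)
    rcases x with _ | b
    · simp
    · cases s <;> cases b <;> simp [epsStrategy_some] <;> nlinarith
  refine le_antisymm hle ?_
  have htop : privLevel (epsStrategy ε) ≠ ⊤ := ne_top_of_le_ne_top ENNReal.ofReal_ne_top hle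
  rw [ENNReal.ofReal_le_iff_le_toReal htop]
  have key := le_of_privLevel_le_ofReal hs (ENNReal.toReal_nonneg)
    (ENNReal.ofReal_toReal htop).ge
  have k1 := key true (some true)
  have k2 := key true (some false)
  simp only [epsStrategy_some] at k1 k2
  simp at k1 k2
  rw [abs_le', ← exp_le_exp, ← exp_le_exp (x := -ε)]
  constructor <;> nlinarith

lemma privCost_epsStrategy (g : ℝ → ℝ) (ε : ℝ) : privCost g (epsStrategy ε) = (g |ε| : ℝ) := by
  rw [privCost, privLevel_epsStrategy, if_neg ENNReal.ofReal_ne_top,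
    ENNReal.toReal_ofReal (abs_nonneg ε)]

/-! ### Chernoff information and the value of privacy -/

/-- The probability that an individual playing the `ε`-strategy reports the true state. -/
noncomputable def truthProb (θ ε : ℝ) : ℝ := θ * sigmoid ε + (1 - θ) * (1 - sigmoid ε)

section

variable {θ : ℝ}

lemma half_lt_truthProb (hθ : 1 / 2 < θ) {ε : ℝ} (hε : 0 < ε) : 1 / 2 < truthProb θ ε := by
  have := half_lt_sigmoid hε
  unfold truthProb
  nlinarith

lemma truthProb_lt_one (hθ : 0 < θ) (hθ1 : θ < 1) (ε : ℝ) : truthProb θ ε < 1 := by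
  have := sigmoid_pos ε
  have := sigmoid_lt_one ε
  unfold truthProb
  nlinarith

lemma dExp_eq (θ ε : ℝ) :
    dExp θ ε = -(1 / 2 * log (4 * (truthProb θ ε * (1 - truthProb θ ε)))) := by
  have hE := exp_pos ε
  have h1 : truthProb θ ε = (θ * exp ε + 1 - θ) / (exp ε + 1) := by
    rw [truthProb, ← one_div_exp_add_one, ← exp_div_exp_add_one]
    field_simp
    ring
  have h2 : 1 - truthProb θ ε = ((1 - θ) * exp ε + θ) / (exp ε + 1) := by
    rw [h1]
    field_simp
    ring
  rw [dExp, h2, h1, ← mul_neg, ← log_inv]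
  congr 2
  rw [div_mul_div_comm, ← mul_div_assoc, inv_div, ← sq]
  congr 1
  ring

lemma exp_neg_dExp_sq (hθ : 1 / 2 < θ) (hθ1 : θ < 1) {ε : ℝ} (hε : 0 < ε) :
    exp (-dExp θ ε) ^ 2 = 4 * (truthProb θ ε * (1 - truthProb θ ε)) := by
  have h1 := half_lt_truthProb hθ hε
  have h2 := truthProb_lt_one (by linarith) hθ1 ε
  rw [dExp_eq, neg_neg, ← exp_nat_mul]
  rw [Nat.cast_ofNat, ← mul_assoc, mul_one_div_cancel two_ne_zero, one_mul, exp_log]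
  nlinarith

lemma dExp_pos (hθ : 1 / 2 < θ) (hθ1 : θ < 1) {ε : ℝ} (hε : 0 < ε) : 0 < dExp θ ε := by
  have h1 := half_lt_truthProb hθ hε
  have h2 := truthProb_lt_one (by linarith) hθ1 ε
  have : log (4 * (truthProb θ ε * (1 - truthProb θ ε))) < 0 :=
    log_neg (by nlinarith) (by nlinarith [sq_pos_of_pos (sub_pos.2 h1)])
  rw [dExp_eq]
  linarith

lemma VLB_eq (hθ : 1 / 2 < θ) (g' : ℝ → ℝ) (ε : ℝ) :
    VLB θ g' ε = g' ε / (sigmoid ε * (1 - sigmoid ε)) * (sigmoid ε + (1 - θ) / (2 * θ - 1)) := by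
  have hE := exp_pos ε
  obtain ⟨d, rfl⟩ : ∃ d, θ = (1 + d) / 2 := ⟨2 * θ - 1, by ring⟩
  have hd : d ≠ 0 := by linarith
  rw [show 2 * ((1 + d) / 2) - 1 = d by ring, ← one_div_exp_add_one, ← exp_div_exp_add_one, VLB,
    show 2 * ((1 + d) / 2) - 1 = d by ring]
  field_simp
  ring

lemma VLB_pos (hθ : 1 / 2 < θ) (hθ1 : θ < 1) {g g' : ℝ → ℝ} (hg : ProperCost g g') {ε : ℝ}
    (hε : 0 < ε) : 0 < VLB θ g' ε := by
  have h1 := sigmoid_pos ε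
  have h2 := sub_pos.2 (sigmoid_lt_one ε)
  have h3 := hg.deriv_pos hε
  have h4 : 0 < 2 * θ - 1 := by linarith
  have h5 : 0 < 1 - θ := by linarith
  rw [VLB_eq hθ]
  positivity

/-- `u` and `v` are the payments made in expectation for a report equal to the state and for a
report different from the state; `payoff θ u v ε` is the resulting expected payment for the
`ε`-strategy. -/
noncomputable def payoff (θ u v ε : ℝ) : ℝ :=
  sigmoid ε * (θ * u + (1 - θ) * v) + (1 - sigmoid ε) * ((1 - θ) * u + θ * v)

lemma payoff_neg (θ u v ε : ℝ) : payoff θ u v (-ε) = payoff θ v u ε := by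
  simp only [payoff, sigmoid_neg]
  ring

lemma payoff_eq_VLB_add (hθ : 1 / 2 < θ) {g' : ℝ → ℝ} {u v ε : ℝ}
    (h : (2 * θ - 1) * (u - v) * (sigmoid ε * (1 - sigmoid ε)) = g' ε) :
    payoff θ u v ε = VLB θ g' ε + v := by
  have h1 := sigmoid_pos ε
  have h2 := sub_pos.2 (sigmoid_lt_one ε)
  rw [VLB_eq hθ, ← h, mul_div_assoc, div_self (by positivity), payoff]
  obtain ⟨d, rfl⟩ : ∃ d, θ = (1 + d) / 2 := ⟨2 * θ - 1, by ring⟩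
  have hd : d ≠ 0 := by linarith
  rw [show 2 * ((1 + d) / 2) - 1 = d by ring]
  field_simp
  ring

lemma VLB_le_payoff (hθ : 1 / 2 < θ) {g g' : ℝ → ℝ} (hg : ProperCost g g') {u v ε : ℝ}
    (hv : 0 ≤ v) (hε : 0 < ε)
    (hmax : ∀ x, 0 < x → payoff θ u v x - g x ≤ payoff θ u v ε - g ε) :
    VLB θ g' ε ≤ payoff θ u v ε := by
  have hloc : IsLocalMax (fun x => payoff θ u v x - g x) ε := by
    filter_upwards [lt_mem_nhds hε] with x hx using hmax x hx
  have hd : HasDerivAt (fun x => payoff θ u v x - g x)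
      (sigmoid ε * (1 - sigmoid ε) * (θ * u + (1 - θ) * v)
        + -(sigmoid ε * (1 - sigmoid ε)) * ((1 - θ) * u + θ * v) - g' ε) ε :=
    (((hasDerivAt_sigmoid ε).mul_const _).add
      (((hasDerivAt_sigmoid ε).const_sub 1).mul_const _)).sub (hg.deriv ε hε.le)
  have h0 := hloc.hasDerivAt_eq_zero hd
  rw [payoff_eq_VLB_add hθ (g' := g') (by linear_combination h0)]
  linarith

end

/-! ### Expected payments -/

/-- `P(X = x | W = w)` when the strategy `σ` is used. -/
def reportProb (θ : ℝ) (σ : Bool → Report → ℝ) (w : Bool) (x : Report) : ℝ :=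
  ∑ s : Bool, signalProb θ w s * σ s x

/-- The prior probability of the state. -/
def prior (p : ℝ) (w : Bool) : ℝ := if w then p else 1 - p

/-- `E[R_i(X) | W = w, X_i = y]`. -/
def condPay {n : ℕ} (θ : ℝ) (σ : Fin (n + 1) → Bool → Report → ℝ)
    (R : (Fin (n + 1) → Report) → Fin (n + 1) → ℝ) (i : Fin (n + 1)) (w : Bool) (y : Report) : ℝ :=
  ∑ z : Fin n → Report,
    (∏ j, reportProb θ (σ (i.succAbove j)) w (z j)) * R (i.insertNth y z) i

lemma sum_jointProb {N : ℕ} (p θ : ℝ) (σ : Fin N → Bool → Report → ℝ) (w : Bool)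
    (x : Fin N → Report) :
    ∑ s : Fin N → Bool, jointProb p θ σ w s x = prior p w * ∏ i, reportProb θ (σ i) w (x i) := by
  simp only [jointProb, reportProb, prior, ← Finset.mul_sum]
  rw [Finset.prod_univ_sum, Fintype.piFinset_univ]

lemma sum_insertNth {n : ℕ} {α M : Type*} [Fintype α] [AddCommMonoid M] (i : Fin (n + 1))
    (f : (Fin (n + 1) → α) → M) :
    ∑ x, f x = ∑ y, ∑ z : Fin n → α, f (i.insertNth y z) := by
  rw [← (Fin.insertNthEquiv (fun _ => α) i).sum_comp, Fintype.sum_prod_type]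
  rfl

lemma expPay_eq {n : ℕ} (p θ : ℝ) (σ : Fin (n + 1) → Bool → Report → ℝ)
    (R : (Fin (n + 1) → Report) → Fin (n + 1) → ℝ) (i : Fin (n + 1)) :
    expPay p θ σ R i =
      ∑ w, prior p w * ∑ y, reportProb θ (σ i) w y * condPay θ σ R i w y := by
  unfold expPay
  refine Finset.sum_congr rfl fun w _ => ?_
  rw [Finset.sum_comm]
  simp only [← Finset.sum_mul, sum_jointProb]
  rw [sum_insertNth i, Finset.mul_sum]
  refine Finset.sum_congr rfl fun y _ => ?_
  rw [condPay, Finset.mul_sum, Finset.mul_sum]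
  refine Finset.sum_congr rfl fun z _ => ?_
  rw [Fin.prod_univ_succAbove _ i]
  simp only [Fin.insertNth_apply_same, Fin.insertNth_apply_succAbove]
  ring

lemma condPay_update {n : ℕ} (θ : ℝ) (σ : Fin (n + 1) → Bool → Report → ℝ)
    (R : (Fin (n + 1) → Report) → Fin (n + 1) → ℝ) (i : Fin (n + 1)) (σ' : Bool → Report → ℝ) :
    condPay θ (Function.update σ i σ') R i = condPay θ σ R i := by
  ext w y
  simp [condPay, Fin.succAbove_ne]

section

variable {p θ : ℝ}

lemma prior_nonneg (hp0 : 0 < p) (hp1 : p < 1) (w : Bool) : 0 ≤ prior p w := by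
  cases w <;> simp [prior] <;> linarith

lemma reportProb_nonneg (hθ : 1 / 2 < θ) (hθ1 : θ < 1) {σ : Bool → Report → ℝ}
    (hσ : IsStrategy σ) (w : Bool) (x : Report) : 0 ≤ reportProb θ σ w x := by
  refine Finset.sum_nonneg fun s _ => mul_nonneg ?_ (hσ.1 s x)
  unfold signalProb
  split_ifs <;> linarith

lemma sum_reportProb {σ : Bool → Report → ℝ} (hσ : IsStrategy σ) (w : Bool) :
    ∑ x, reportProb θ σ w x = 1 := by
  simp only [reportProb]
  rw [Finset.sum_comm]
  simp only [← Finset.mul_sum, hσ.2]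
  cases w <;> simp [signalProb]

lemma condPay_nonneg (hθ : 1 / 2 < θ) (hθ1 : θ < 1) {n : ℕ}
    {σ : Fin (n + 1) → Bool → Report → ℝ} (hσ : ∀ i, IsStrategy (σ i))
    {R : (Fin (n + 1) → Report) → Fin (n + 1) → ℝ} (hR : ∀ x i, 0 ≤ R x i) (i : Fin (n + 1))
    (w : Bool) (y : Report) : 0 ≤ condPay θ σ R i w y :=
  Finset.sum_nonneg fun _ _ => mul_nonneg
    (Finset.prod_nonneg fun _ _ => reportProb_nonneg hθ hθ1 (hσ _) _ _) (hR _ _)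

lemma expPay_nonneg (hp0 : 0 < p) (hp1 : p < 1) (hθ : 1 / 2 < θ) (hθ1 : θ < 1) {N : ℕ}
    {σ : Fin N → Bool → Report → ℝ} (hσ : ∀ i, IsStrategy (σ i))
    {R : (Fin N → Report) → Fin N → ℝ} (hR : ∀ x i, 0 ≤ R x i) (i : Fin N) :
    0 ≤ expPay p θ σ R i := by
  rcases N with _ | n
  · exact i.elim0
  rw [expPay_eq]
  exact Finset.sum_nonneg fun w _ => mul_nonneg (prior_nonneg hp0 hp1 w) <|
    Finset.sum_nonneg fun y _ => mul_nonneg (reportProb_nonneg hθ hθ1 (hσ i) w y)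
      (condPay_nonneg hθ hθ1 hσ hR i w y)

lemma reportProb_epsStrategy (θ ε : ℝ) (w b : Bool) :
    reportProb θ (epsStrategy ε) w (some b) =
      if b = w then truthProb θ ε else 1 - truthProb θ ε := by
  cases w <;> cases b <;> simp [reportProb, signalProb, epsStrategy_some, truthProb] <;> ring

@[simp] lemma reportProb_epsStrategy_none (θ ε : ℝ) (w : Bool) :
    reportProb θ (epsStrategy ε) w none = 0 := by
  simp [reportProb]

lemma sum_reportProb_epsStrategy (p θ ε : ℝ) (G : Bool → Report → ℝ) :
    ∑ w, prior p w * ∑ y, reportProb θ (epsStrategy ε) w y * G w y =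
      payoff θ (∑ w, prior p w * G w (some w)) (∑ w, prior p w * G w (some !w)) ε := by
  simp [Fintype.sum_option, reportProb_epsStrategy, truthProb, payoff, prior]
  ring

lemma VLB_le_expPay (hp0 : 0 < p) (hp1 : p < 1) (hθ : 1 / 2 < θ) (hθ1 : θ < 1) {g g' : ℝ → ℝ}
    (hg : ProperCost g g') {N : ℕ} {σ : Fin N → Bool → Report → ℝ}
    {R : (Fin N → Report) → Fin N → ℝ} (hR : ∀ x i, 0 ≤ R x i) (hN : NashEq p θ g σ R)
    {i : Fin N} {ε : ℝ} (hε : ε ≠ 0) (hi : σ i = epsStrategy ε) :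
    VLB θ g' |ε| ≤ expPay p θ σ R i := by
  rcases N with _ | n
  · exact i.elim0
  have hnn (w y) : 0 ≤ prior p w * condPay θ σ R i w y :=
    mul_nonneg (prior_nonneg hp0 hp1 w) (condPay_nonneg hθ hθ1 hN.1 hR i w y)
  set u := ∑ w, prior p w * condPay θ σ R i w (some w) with hu
  set v := ∑ w, prior p w * condPay θ σ R i w (some !w) with hv
  have hu0 : 0 ≤ u := Finset.sum_nonneg fun _ _ => hnn _ _
  have hv0 : 0 ≤ v := Finset.sum_nonneg fun _ _ => hnn _ _
  have hdev (x : ℝ) : payoff θ u v x - g |x| ≤ payoff θ u v ε - g |ε| := by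
    have := hN.2 i (epsStrategy x) (isStrategy_epsStrategy x)
    simp only [utility, expPay_eq, condPay_update, hi, Function.update_self,
      privCost_epsStrategy, sum_reportProb_epsStrategy] at this
    rw [← EReal.coe_sub, ← EReal.coe_sub, EReal.coe_le_coe_iff] at this
    exact this
  rw [expPay_eq, hi, sum_reportProb_epsStrategy, ← hu, ← hv]
  rcases hε.lt_or_gt with h | h
  · obtain ⟨e, rfl⟩ : ∃ e, ε = -e := ⟨-ε, (neg_neg ε).symm⟩
    rw [abs_neg, abs_of_pos (by linarith), payoff_neg]
    refine VLB_le_payoff hθ hg hu0 (by linarith) fun x hx => ?_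
    have := hdev (-x)
    rwa [payoff_neg, payoff_neg, abs_neg, abs_neg, abs_of_pos hx, abs_of_pos (by linarith)] at this
  · rw [abs_of_pos h]
    refine VLB_le_payoff hθ hg hv0 h fun x hx => ?_
    have := hdev x
    rwa [abs_of_pos hx, abs_of_pos h] at this

end

/-! ### A peer-prediction mechanism based on majority voting -/

/-- The signed contribution of a report to the vote. -/
def score : Report → ℤ
  | none => 0
  | some true => 1
  | some false => -1

/-- The majority report, with ties broken in favour of `false`. -/
def majority {n : ℕ} (z : Fin n → Report) : Bool := decide (0 < ∑ j, score (z j))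

/-- Each individual is paid `c b` when reporting the majority report `b` of the others. -/
def peerPay {n : ℕ} (c : Bool → ℝ) (x : Fin (n + 1) → Report) (i : Fin (n + 1)) : ℝ :=
  if x i = some (majority (i.removeNth x)) then c (majority (i.removeNth x)) else 0

/-- The probability that the majority report of `n` individuals playing the `ε`-strategy is `b`
when the state is `w`. -/
noncomputable def majorityProb (θ ε : ℝ) (n : ℕ) (w b : Bool) : ℝ :=
  ∑ z : Fin n → Report,
    (∏ j, reportProb θ (epsStrategy ε) w (z j)) * if majority z = b then 1 else 0

section

variable {p θ : ℝ}

lemma condPay_peerPay_some (θ ε : ℝ) {n : ℕ} (c : Bool → ℝ) (i : Fin (n + 1)) (w b : Bool) :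
    condPay θ (fun _ => epsStrategy ε) (peerPay c) i w (some b) =
      c b * majorityProb θ ε n w b := by
  rw [condPay, majorityProb, Finset.mul_sum]
  refine Finset.sum_congr rfl fun z _ => ?_
  simp only [peerPay, Fin.insertNth_apply_same, Fin.removeNth_insertNth, Option.some.injEq,
    eq_comm (a := b)]
  split_ifs with h
  · rw [h]
    ring
  · ring

lemma condPay_peerPay_none (θ ε : ℝ) {n : ℕ} (c : Bool → ℝ) (i : Fin (n + 1)) (w : Bool) :
    condPay θ (fun _ => epsStrategy ε) (peerPay c) i w none = 0 := by
  simp [condPay, peerPay]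

lemma majorityProb_nonneg (hθ : 1 / 2 < θ) (hθ1 : θ < 1) (ε : ℝ) (n : ℕ) (w b : Bool) :
    0 ≤ majorityProb θ ε n w b :=
  Finset.sum_nonneg fun z _ => mul_nonneg
    (Finset.prod_nonneg fun j _ =>
      reportProb_nonneg hθ hθ1 (isStrategy_epsStrategy ε) w (z j))
    (by split_ifs <;> norm_num)

lemma majorityProb_add (θ ε : ℝ) (n : ℕ) (w : Bool) :
    majorityProb θ ε n w w + majorityProb θ ε n w (!w) = 1 := by
  rw [majorityProb, majorityProb, ← Finset.sum_add_distrib]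
  have (z : Fin n → Report) :
      (if majority z = w then (1 : ℝ) else 0) + (if majority z = !w then 1 else 0) = 1 := by
    cases majority z <;> cases w <;> simp
  simp only [← mul_add, this, mul_one]
  rw [← Fintype.piFinset_univ, ← Finset.prod_univ_sum]
  simp [sum_reportProb (isStrategy_epsStrategy ε)]

/-- The Chernoff bound for the majority vote. -/
lemma majorityProb_not_le (hθ : 1 / 2 < θ) (hθ1 : θ < 1) {ε : ℝ} (hε : 0 < ε) (n : ℕ) (w : Bool) :
    majorityProb θ ε n w (!w) ≤ exp (-(n * dExp θ ε)) := by
  have h1 := half_lt_truthProb hθ hε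
  have h2 := truthProb_lt_one (by linarith) hθ1 ε
  set r := truthProb θ ε with hr
  set l := 1 / 2 * log (r / (1 - r)) with hl
  have hr0 : 0 < 1 - r := by linarith
  have hl0 : 0 ≤ l := mul_nonneg (by norm_num) (log_nonneg (by rw [le_div_iff₀ hr0]; linarith))
  have hexp : exp l ^ 2 = r / (1 - r) := by
    rw [← exp_nat_mul, hl, Nat.cast_ofNat, ← mul_assoc, mul_one_div_cancel two_ne_zero, one_mul,
      exp_log (by positivity)]
  have hmgf : r * exp (-l) + (1 - r) * exp l = exp (-dExp θ ε) := by
    rw [← sq_eq_sq₀ (by positivity) (exp_pos _).le, exp_neg_dExp_sq hθ hθ1 hε, ← hr, exp_neg]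
    have hE := exp_pos l
    have hE2 : r = exp l ^ 2 * (1 - r) := by rw [hexp]; field_simp
    have : r * (exp l)⁻¹ = (1 - r) * exp l := by
      rw [← div_eq_mul_inv, div_eq_iff hE.ne']
      linear_combination hE2
    rw [this]
    linear_combination (-4 * (1 - r)) * hE2
  set sgn : ℝ := if w then 1 else -1 with hsgn
  have hweight (z : Fin n → Report) :
      (if majority z = !w then (1 : ℝ) else 0) ≤ ∏ j, exp (-(l * (sgn * score (z j)))) := by
    split_ifs with h
    · rw [← exp_sum, one_le_exp_iff, Finset.sum_neg_distrib, ← Finset.mul_sum, ← Finset.mul_sum,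
        ← Int.cast_sum]
      suffices sgn * ((∑ j, score (z j) : ℤ) : ℝ) ≤ 0 by nlinarith
      cases w
      · have h : 0 < ∑ j, score (z j) := by simpa [majority] using h
        have h : (0 : ℝ) < ((∑ j, score (z j) : ℤ) : ℝ) := by exact_mod_cast h
        simp only [hsgn, Bool.false_eq_true, if_false]
        linarith
      · have h : ∑ j, score (z j) ≤ 0 := by simpa [majority] using h
        have h : ((∑ j, score (z j) : ℤ) : ℝ) ≤ 0 := by exact_mod_cast h
        simpa [hsgn] using h
    · exact Finset.prod_nonneg fun _ _ => (exp_pos _).le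
  have hone : ∑ x, reportProb θ (epsStrategy ε) w x * exp (-(l * (sgn * score x))) =
      exp (-dExp θ ε) := by
    rw [← hmgf]
    cases w <;> simp [Fintype.sum_option, reportProb_epsStrategy, score, hsgn, hr]; ring
  calc majorityProb θ ε n w (!w)
      ≤ ∑ z : Fin n → Report, ∏ j,
          (reportProb θ (epsStrategy ε) w (z j) * exp (-(l * (sgn * score (z j))))) := by
        refine Finset.sum_le_sum fun z _ => ?_
        rw [Finset.prod_mul_distrib]
        exact mul_le_mul_of_nonneg_left (hweight z) (Finset.prod_nonneg fun j _ =>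
          reportProb_nonneg hθ hθ1 (isStrategy_epsStrategy ε) w (z j))
    _ = exp (-(n * dExp θ ε)) := by
        rw [← Fintype.piFinset_univ, ← Finset.prod_univ_sum
          (f := fun _ x => reportProb θ (epsStrategy ε) w x * exp (-(l * (sgn * score x))))]
        rw [Finset.prod_const, hone, ← exp_nat_mul, Finset.card_univ, Fintype.card_fin, mul_neg]

/-- Weak duality for the problem of maximizing expected payment under a privacy constraint;
`A s b` is the payoff of report `b` for signal `s` and `x s b` is the probability of that report. -/
lemma dual_bound {A x : Bool → Bool → ℝ} {q κ : ℝ} (hA : ∀ s b, 0 ≤ A s b)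
    (hq0 : 0 ≤ q) (hq1 : q ≤ 1) (hκ : 0 ≤ κ) (h1 : A true true - A true false = κ)
    (h0 : A false false - A false true = κ) (hx : ∀ s, x s true + x s false ≤ 1)
    (hpriv : ∀ s b, (1 - q) * x s b ≤ q * x (!s) b) :
    ∑ s, ∑ b, x s b * A s b ≤
      q * (A true true + A false false) + (1 - q) * (A true false + A false true) := by
  have hq1' := sub_nonneg.2 hq1
  have k1 : 0 ≤ q * A true true + (1 - q) * A true false :=
    add_nonneg (mul_nonneg hq0 (hA _ _)) (mul_nonneg hq1' (hA _ _))
  have k0 : 0 ≤ q * A false false + (1 - q) * A false true :=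
    add_nonneg (mul_nonneg hq0 (hA _ _)) (mul_nonneg hq1' (hA _ _))
  have m1 := mul_nonneg k1 (sub_nonneg.2 (hx true))
  have m0 := mul_nonneg k0 (sub_nonneg.2 (hx false))
  have n1 := mul_nonneg hκ (sub_nonneg.2 (hpriv true true))
  have n0 := mul_nonneg hκ (sub_nonneg.2 (hpriv false false))
  simp only [Bool.not_true, Bool.not_false] at n1 n0
  simp only [Fintype.sum_bool]
  rw [sub_eq_iff_eq_add] at h1 h0
  simp only [h1, h0] at m1 m0 ⊢
  linarith

/-- If the expected payments for the two reports coincide and nonparticipation is not paid, then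
among all strategies of privacy level at most `ζ` the `ζ`-strategy earns the most. -/
lemma expectedPay_le_payoff (hp0 : 0 < p) (hp1 : p < 1) (hθ : 1 / 2 < θ) (hθ1 : θ < 1)
    {G : Bool → Report → ℝ} (hG : ∀ w y, 0 ≤ G w y) (hnone : ∀ w, G w none = 0)
    (hbal : ∑ w, prior p w * G w (some true) = ∑ w, prior p w * G w (some false))
    (huv : ∑ w, prior p w * G w (some !w) ≤ ∑ w, prior p w * G w (some w))
    {σ : Bool → Report → ℝ} (hσ : IsStrategy σ) {ζ : ℝ}
    (hpriv : ∀ s x, σ s x ≤ exp ζ * σ (!s) x) :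
    ∑ w, prior p w * ∑ y, reportProb θ σ w y * G w y ≤
      payoff θ (∑ w, prior p w * G w (some w)) (∑ w, prior p w * G w (some !w)) ζ := by
  have hq1 := sub_pos.2 (sigmoid_lt_one ζ)
  have hpriv' (s x) : (1 - sigmoid ζ) * σ s x ≤ sigmoid ζ * σ (!s) x := by
    have := mul_le_mul_of_nonneg_left (hpriv s x) hq1.le
    rwa [← mul_assoc, one_sub_sigmoid_mul_exp] at this
  have hPG (w y) : 0 ≤ prior p w * G w y := mul_nonneg (prior_nonneg hp0 hp1 w) (hG w y)
  simp only [Fintype.sum_bool, Bool.not_true, Bool.not_false] at hbal huv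
  have hdual := dual_bound (A := fun s b => ∑ w, signalProb θ w s * (prior p w * G w (some b)))
    (x := fun s b => σ s (some b)) (q := sigmoid ζ)
    (κ := (2 * θ - 1) * (prior p true * G true (some true) - prior p true * G true (some false)))
    (fun s b => Finset.sum_nonneg fun w _ => mul_nonneg
      (by unfold signalProb; split_ifs <;> linarith) (hPG w _))
    (sigmoid_nonneg ζ) (sigmoid_le_one ζ) (mul_nonneg (by linarith) (by linarith))
    (by simp [signalProb]; linear_combination (1 - θ) * hbal)
    (by simp [signalProb]; linear_combination (-θ) * hbal)
    (fun s => by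
      have h1 := hσ.2 s
      have h2 := hσ.1 s none
      simp only [Fintype.sum_option, Fintype.sum_bool] at h1
      linarith)
    (fun s b => hpriv' s _)
  calc _ = _ := ?_
    _ ≤ _ := hdual
    _ = _ := ?_
  · simp only [Fintype.sum_option, Fintype.sum_bool, hnone, reportProb]
    ring
  · simp [payoff, signalProb]
    ring

end

section

variable {p θ : ℝ}

lemma payoff_sub_cost_le {g g' : ℝ → ℝ} (hg : ProperCost g g') (hθ : 1 / 2 < θ) {u v ε ζ : ℝ}
    (hε : 0 < ε) (hζ : 0 ≤ ζ) (huv : v ≤ u)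
    (h : (2 * θ - 1) * (u - v) * (sigmoid ε * (1 - sigmoid ε)) = g' ε) :
    payoff θ u v ζ - g ζ ≤ payoff θ u v ε - g ε := by
  have h1 := hg.tangent_le hε.le hζ
  have h2 := mul_le_mul_of_nonneg_left (sigmoid_tangent_ge hε.le hζ)
    (mul_nonneg (by linarith : 0 ≤ 2 * θ - 1) (sub_nonneg.2 huv))
  rw [← h] at h1
  unfold payoff
  linarith

lemma nashEq_peerPay (hp0 : 0 < p) (hp1 : p < 1) (hθ : 1 / 2 < θ) (hθ1 : θ < 1) {g g' : ℝ → ℝ}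
    (hg : ProperCost g g') {ε : ℝ} (hε : 0 < ε) {n : ℕ} {c : Bool → ℝ} (hc : ∀ b, 0 ≤ c b)
    (hbal : ∑ w, prior p w * (c true * majorityProb θ ε n w true) =
      ∑ w, prior p w * (c false * majorityProb θ ε n w false))
    {u v : ℝ} (hu : u = ∑ w, prior p w * (c w * majorityProb θ ε n w w))
    (hv : v = ∑ w, prior p w * (c (!w) * majorityProb θ ε n w (!w))) (huv : v ≤ u)
    (hfoc : (2 * θ - 1) * (u - v) * (sigmoid ε * (1 - sigmoid ε)) = g' ε) :
    NashEq p θ g (fun _ : Fin (n + 1) => epsStrategy ε) (peerPay c) := by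
  refine ⟨fun _ => isStrategy_epsStrategy ε, fun i σ' hσ' => ?_⟩
  simp only [utility, expPay_eq, condPay_update, Function.update_self, privCost_epsStrategy,
    sum_reportProb_epsStrategy, condPay_peerPay_some, ← hu, ← hv, abs_of_pos hε]
  rw [← EReal.coe_sub]
  by_cases htop : privLevel σ' = ⊤
  · rw [privCost, if_pos htop, hg.iSup_eq_top, sub_eq_add_neg,
      EReal.neg_top, EReal.add_bot]
    exact bot_le
  rw [privCost, if_neg htop, ← EReal.coe_sub, EReal.coe_le_coe_iff]
  refine le_trans (sub_le_sub_right ?_ _)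
    (payoff_sub_cost_le hg hθ hε (ENNReal.toReal_nonneg (a := privLevel σ')) huv hfoc)
  have hpay := expectedPay_le_payoff hp0 hp1 hθ hθ1
    (G := condPay θ (fun _ => epsStrategy ε) (peerPay c) i)
    (condPay_nonneg hθ hθ1 (fun _ => isStrategy_epsStrategy ε)
      (fun x j => by unfold peerPay; split_ifs <;> simp [hc]) i)
    (condPay_peerPay_none θ ε c i)
    (by simpa only [condPay_peerPay_some] using hbal)
    (by simpa only [condPay_peerPay_some, ← hu, ← hv] using huv) hσ'
    (le_of_privLevel_le_ofReal hσ'.1 ENNReal.toReal_nonneg (ENNReal.ofReal_toReal htop).ge)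
  simpa only [condPay_peerPay_some, ← hu, ← hv] using hpay

lemma expPay_peerPay (p θ ε : ℝ) {n : ℕ} (c : Bool → ℝ) (i : Fin (n + 1)) :
    expPay p θ (fun _ => epsStrategy ε) (peerPay c) i =
      payoff θ (∑ w, prior p w * (c w * majorityProb θ ε n w w))
        (∑ w, prior p w * (c (!w) * majorityProb θ ε n w (!w))) ε := by
  simp only [expPay_eq, sum_reportProb_epsStrategy, condPay_peerPay_some]

/-- Rewards inversely proportional to the probabilities of the two verdicts of an estimator `Q` of
the state with small error probability `δ`; the payments made for reports different from the
state are then of order `δ`. -/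
lemma exists_rewards (hp0 : 0 < p) (hp1 : p < 1) {Q : Bool → Bool → ℝ} (hQ : ∀ w b, 0 ≤ Q w b)
    (hsum : ∀ w, Q w w + Q w (!w) = 1) {δ : ℝ} (hδ : ∀ w, Q w (!w) ≤ δ) (hδp : δ ≤ p / 8)
    (hδp' : δ ≤ (1 - p) / 8) {K : ℝ} (hK : 0 < K) :
    ∃ c : Bool → ℝ, (∀ b, 0 ≤ c b) ∧
      ∑ w, prior p w * (c true * Q w true) = ∑ w, prior p w * (c false * Q w false) ∧
      ∑ w, prior p w * (c w * Q w w) - ∑ w, prior p w * (c (!w) * Q w (!w)) = K ∧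
      ∑ w, prior p w * (c (!w) * Q w (!w)) ≤ 2 * K * (1 / p + 1 / (1 - p)) * δ := by
  have hp1' := sub_pos.2 hp1
  have s1 := hsum true
  have s0 := hsum false
  have d1 := hδ true
  have d0 := hδ false
  simp only [Bool.not_true, Bool.not_false] at s1 s0 d1 d0
  have hδ0 := (hQ _ _).trans d0
  set M : Bool → ℝ := fun b => ∑ w, prior p w * Q w b with hM
  have hMt : M true = p * Q true true + (1 - p) * Q false true := by simp [hM, prior]
  have hMf : M false = p * Q true false + (1 - p) * Q false false := by simp [hM, prior]
  have hMt' : p / 2 ≤ M true := by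
    rw [hMt]
    nlinarith [mul_nonneg hp1'.le (hQ false true)]
  have hMf' : (1 - p) / 2 ≤ M false := by
    rw [hMf]
    nlinarith [mul_nonneg hp0.le (hQ true false)]
  have hMt0 : 0 < M true := by linarith
  have hMf0 : 0 < M false := by linarith
  set a := (1 - p) * Q false true / M true with ha
  set b := p * Q true false / M false with hb
  have ha' : a ≤ 2 * (1 / p) * δ := by
    rw [ha, div_le_iff₀ hMt0]
    calc (1 - p) * Q false true ≤ 1 * δ := by
          gcongr
          · exact hQ _ _
          · linarith
      _ = 2 * (1 / p) * δ * (p / 2) := by field_simp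
      _ ≤ _ := by gcongr
  have hb' : b ≤ 2 * (1 / (1 - p)) * δ := by
    rw [hb, div_le_iff₀ hMf0]
    calc p * Q true false ≤ 1 * δ := by
          gcongr
          exact hQ _ _
      _ = 2 * (1 / (1 - p)) * δ * ((1 - p) / 2) := by field_simp
      _ ≤ _ := by gcongr
  have ha4 : a ≤ 1 / 4 := ha'.trans <| by
    calc 2 * (1 / p) * δ ≤ 2 * (1 / p) * (p / 8) := by gcongr
      _ = 1 / 4 := by field_simp; norm_num
  have hb4 : b ≤ 1 / 4 := hb'.trans <| by
    calc 2 * (1 / (1 - p)) * δ ≤ 2 * (1 / (1 - p)) * ((1 - p) / 8) := by gcongr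
      _ = 1 / 4 := by field_simp; norm_num
  have ha0 : 0 ≤ a := div_nonneg (mul_nonneg hp1'.le (hQ _ _)) hMt0.le
  have hb0 : 0 ≤ b := div_nonneg (mul_nonneg hp0.le (hQ _ _)) hMf0.le
  have hab : 0 < 1 - a - b := by linarith
  set k := K / (2 * (1 - a - b)) with hk
  have hk0 : 0 < k := by positivity
  have hkK : k ≤ K := by
    rw [hk, div_le_iff₀ (by positivity)]
    nlinarith
  have hkeq : k * (2 * (1 - a - b)) = K := by
    rw [hk]
    field_simp
  have hMM (b : Bool) : 0 < M b := by cases b <;> assumption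
  have hright : ∑ w, prior p w * (k / M w * Q w w) = k * ((1 - a) + (1 - b)) := by
    have e1 : 1 - a = p * Q true true / M true := by
      rw [ha, hMt]
      rw [hMt] at hMt0
      field_simp
      ring
    have e0 : 1 - b = (1 - p) * Q false false / M false := by
      rw [hb, hMf]
      rw [hMf] at hMf0
      field_simp
      ring
    rw [e1, e0]
    simp [prior]
    ring
  have hwrong : ∑ w, prior p w * (k / M (!w) * Q w (!w)) = k * (a + b) := by
    simp [prior, ha, hb]
    ring
  have htotal (b : Bool) : ∑ w, prior p w * (k / M b * Q w b) = k := by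
    have := (hMM b).ne'
    calc _ = k / M b * M b := by
          rw [hM, Finset.mul_sum]
          exact Finset.sum_congr rfl fun w _ => by ring
      _ = k := by field_simp
  refine ⟨fun b => k / M b, fun b => (div_pos hk0 (hMM b)).le, ?_, ?_, ?_⟩
  · rw [htotal, htotal]
  · rw [hright, hwrong]
    linarith
  · rw [hwrong]
    calc k * (a + b) ≤ K * (2 * (1 / p) * δ + 2 * (1 / (1 - p)) * δ) := by gcongr
      _ = _ := by ring

/-- `n + 1` individuals can be induced to play the `ε`-strategy at a total payment exceeding
`(n + 1) * VLB` by little, provided the majority vote of `n` of them is reliable. -/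
lemma exists_mechanism (hp0 : 0 < p) (hp1 : p < 1) (hθ : 1 / 2 < θ) (hθ1 : θ < 1) {g g' : ℝ → ℝ}
    (hg : ProperCost g g') {ε : ℝ} (hε : 0 < ε) :
    ∃ B > 0, ∀ n : ℕ, exp (-(n * dExp θ ε)) ≤ min p (1 - p) / 8 →
      ∃ R : (Fin (n + 1) → Report) → Fin (n + 1) → ℝ, (∀ x i, 0 ≤ R x i) ∧
        NashEq p θ g (fun _ => epsStrategy ε) R ∧
        ∀ i, expPay p θ (fun _ => epsStrategy ε) R i ≤
          VLB θ g' ε + B * exp (-(n * dExp θ ε)) := by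
  have hq0 := sigmoid_pos ε
  have hq1 := sub_pos.2 (sigmoid_lt_one ε)
  have hθ' : 0 < 2 * θ - 1 := by linarith
  have hp1' := sub_pos.2 hp1
  set K := g' ε / ((2 * θ - 1) * (sigmoid ε * (1 - sigmoid ε))) with hKdef
  have hK : 0 < K := div_pos (hg.deriv_pos hε) (by positivity)
  refine ⟨2 * K * (1 / p + 1 / (1 - p)), by positivity, fun n hn => ?_⟩
  obtain ⟨c, hc, hbal, hdiff, herr⟩ := exists_rewards hp0 hp1 (Q := majorityProb θ ε n)
    (majorityProb_nonneg hθ hθ1 ε n) (majorityProb_add θ ε n)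
    (majorityProb_not_le hθ hθ1 hε n) (by linarith [min_le_left p (1 - p)])
    (by linarith [min_le_right p (1 - p)]) hK
  have hfoc : (2 * θ - 1) * (∑ w, prior p w * (c w * majorityProb θ ε n w w) -
      ∑ w, prior p w * (c (!w) * majorityProb θ ε n w (!w))) *
        (sigmoid ε * (1 - sigmoid ε)) = g' ε := by
    rw [hdiff, hKdef]
    field_simp
  refine ⟨peerPay c, fun x i => ?_, ?_, fun i => ?_⟩
  · unfold peerPay
    split_ifs <;> simp [hc]
  · exact nashEq_peerPay hp0 hp1 hθ hθ1 hg hε hc hbal rfl rfl (by linarith) hfoc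
  · rw [expPay_peerPay, payoff_eq_VLB_add hθ hfoc]
    linarith

/-- The total payments feasible in the definition of `Fpay`. -/
def FeasibleTotal (p θ : ℝ) (g : ℝ → ℝ) (τ t : ℝ) : Prop :=
  ∃ (N : ℕ) (e : Fin N → Option ℝ)
    (σ : Fin N → Bool → Report → ℝ) (R : (Fin N → Report) → Fin N → ℝ),
    (∀ x i, 0 ≤ R x i) ∧
    (∀ i : Fin N, match e i with
      | some ei => ei ≠ 0 ∧ σ i = epsStrategy ei
      | none => IsStrategy (σ i) ∧ NonInformative (σ i)) ∧
    NashEq p θ g σ R ∧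
    Real.exp (-(∑ i : Fin N, DOpt θ (e i))) ≤ τ ∧
    t = ∑ i : Fin N, expPay p θ σ R i

lemma FeasibleTotal.mono {g : ℝ → ℝ} {τ τ' t : ℝ} (h : FeasibleTotal p θ g τ t) (hτ : τ ≤ τ') :
    FeasibleTotal p θ g τ' t := by
  obtain ⟨N, e, σ, R, h1, h2, h3, h4, h5⟩ := h
  exact ⟨N, e, σ, R, h1, h2, h3, h4.trans hτ, h5⟩

lemma FeasibleTotal.nonneg {g : ℝ → ℝ} (hp0 : 0 < p) (hp1 : p < 1) (hθ : 1 / 2 < θ) (hθ1 : θ < 1)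
    {τ t : ℝ} (h : FeasibleTotal p θ g τ t) : 0 ≤ t := by
  obtain ⟨N, e, σ, R, hR, -, hN, -, rfl⟩ := h
  exact Finset.sum_nonneg fun i _ => expPay_nonneg hp0 hp1 hθ hθ1 hN.1 hR i

lemma FeasibleTotal.log_mul_le {g g' : ℝ → ℝ} (hg : ProperCost g g') (hp0 : 0 < p) (hp1 : p < 1)
    (hθ : 1 / 2 < θ) (hθ1 : θ < 1) {ρ : ℝ} (hρ0 : 0 ≤ ρ)
    (hρ : ∀ ε, 0 < ε → ρ * dExp θ ε ≤ VLB θ g' ε) {τ t : ℝ} (hτ : 0 < τ)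
    (h : FeasibleTotal p θ g τ t) : ρ * log (1 / τ) ≤ t := by
  obtain ⟨N, e, σ, R, hR, he, hN, hacc, rfl⟩ := h
  have hlog : log (1 / τ) ≤ ∑ i, DOpt θ (e i) := by
    rw [← le_log_iff_exp_le hτ] at hacc
    rw [one_div, log_inv]
    linarith
  refine (mul_le_mul_of_nonneg_left hlog hρ0).trans ?_
  rw [Finset.mul_sum]
  refine Finset.sum_le_sum fun i _ => ?_
  have hi := he i
  rcases hei : e i with _ | ε
  · simpa [DOpt] using expPay_nonneg hp0 hp1 hθ hθ1 hN.1 hR i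
  · rw [hei] at hi
    exact (hρ _ (abs_pos.2 hi.1)).trans (VLB_le_expPay hp0 hp1 hθ hθ1 hg hR hN hi.1 hi.2)

lemma exists_feasibleTotal (hp0 : 0 < p) (hp1 : p < 1) (hθ : 1 / 2 < θ) (hθ1 : θ < 1)
    {g g' : ℝ → ℝ} (hg : ProperCost g g') {ε : ℝ} (hε : 0 < ε) :
    ∃ C : ℝ, 0 < C ∧ ∃ τ₀ : ℝ, 0 < τ₀ ∧ τ₀ < 1 ∧ ∀ τ : ℝ, 0 < τ → τ < τ₀ →
      ∃ t, FeasibleTotal p θ g τ t ∧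
        t ≤ (⌈log (1 / τ) / dExp θ ε⌉₊ : ℝ) * VLB θ g' ε + C * τ * log (1 / τ) := by
  obtain ⟨B, hB, hmech⟩ := exists_mechanism hp0 hp1 hθ hθ1 hg hε
  have hD := dExp_pos hθ hθ1 hε
  have hmin : 0 < min p (1 - p) := lt_min hp0 (sub_pos.2 hp1)
  refine ⟨(1 / dExp θ ε + 1) * (B * exp (dExp θ ε)), by positivity,
    min (exp (-1)) (min p (1 - p) / 8 * exp (-dExp θ ε)), by positivity,
    (min_le_left _ _).trans_lt (by simp), fun τ hτ hττ => ?_⟩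
  rw [lt_min_iff] at hττ
  have hlog : 1 ≤ log (1 / τ) := by
    rw [one_div, log_inv, le_neg, log_le_iff_le_exp hτ]
    exact hττ.1.le
  set N := ⌈log (1 / τ) / dExp θ ε⌉₊ with hNdef
  have hN0 : 0 < N := Nat.ceil_pos.2 (by positivity)
  have hN1 : log (1 / τ) ≤ N * dExp θ ε := by
    rw [← div_le_iff₀ hD]
    exact Nat.le_ceil _
  have hN2 : (N : ℝ) ≤ (1 / dExp θ ε + 1) * log (1 / τ) := by
    have := Nat.ceil_lt_add_one (a := log (1 / τ) / dExp θ ε) (by positivity)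
    rw [← hNdef] at this
    calc (N : ℝ) ≤ log (1 / τ) / dExp θ ε + 1 := this.le
      _ ≤ log (1 / τ) / dExp θ ε + log (1 / τ) := by gcongr
      _ = _ := by ring
  have hacc : exp (-(N * dExp θ ε)) ≤ τ := by
    rw [← le_log_iff_exp_le hτ]
    rw [one_div, log_inv] at hN1
    linarith
  obtain ⟨n, hn⟩ : ∃ n, N = n + 1 := ⟨N - 1, by omega⟩
  clear_value N
  subst hn
  have herr : exp (-(n * dExp θ ε)) ≤ exp (dExp θ ε) * τ := by
    calc exp (-(n * dExp θ ε)) = exp (dExp θ ε) * exp (-((n + 1 : ℕ) * dExp θ ε)) := by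
          rw [← exp_add]
          push_cast
          ring_nf
      _ ≤ _ := by gcongr
  obtain ⟨R, hR, hNash, hpay⟩ := hmech n <| herr.trans <| by
    calc exp (dExp θ ε) * τ ≤ exp (dExp θ ε) * (min p (1 - p) / 8 * exp (-dExp θ ε)) := by
          gcongr
          exact hττ.2.le
      _ = min p (1 - p) / 8 := by
          rw [exp_neg]
          field_simp
  refine ⟨_, ⟨n + 1, fun _ => some ε, fun _ => epsStrategy ε, R, hR,
    fun _ => ⟨hε.ne', rfl⟩, hNash, ?_, rfl⟩, ?_⟩
  · simpa [DOpt, abs_of_pos hε] using hacc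
  · calc ∑ i, expPay p θ (fun _ => epsStrategy ε) R i
        ≤ ∑ _i : Fin (n + 1), (VLB θ g' ε + B * (exp (dExp θ ε) * τ)) :=
          Finset.sum_le_sum fun i _ => (hpay i).trans (by gcongr)
      _ = ((n + 1 : ℕ) : ℝ) * VLB θ g' ε + ((n + 1 : ℕ) : ℝ) * (B * (exp (dExp θ ε) * τ)) := by
          rw [Finset.sum_const, Finset.card_univ, Fintype.card_fin, nsmul_eq_mul, mul_add]
      _ ≤ ((n + 1 : ℕ) : ℝ) * VLB θ g' ε +
            (1 / dExp θ ε + 1) * log (1 / τ) * (B * (exp (dExp θ ε) * τ)) := by gcongr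
      _ = _ := by ring

end

/-- **Theorem 3 (payment–accuracy bounds).**
If `ε̃` is the least element of `argmax_{ε>0} D(ε)/V_LB(ε)` and
`Ñ(τ) = ⌈ln(1/τ)/D(ε̃)⌉`, then `F(τ) ≥ (Ñ(τ)−1)·V_LB(ε̃)` for all `τ ∈ (0,1)`, and
there are `C > 0` and `τ₀ ∈ (0,1)` with `F(τ) ≤ Ñ(τ)·V_LB(ε̃) + C·τ·ln(1/τ)` for all
`τ ∈ (0,τ₀)`. -/
theorem payment_accuracy_bounds
    (p θ : ℝ) (hp0 : 0 < p) (hp1 : p < 1)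
    (hθ : 1/2 < θ) (hθ1 : θ < 1)
    (g g' : ℝ → ℝ) (hg : ProperCost g g')
    (εt : ℝ)
    (hεt : IsLeast {ε : ℝ | 0 < ε ∧ ∀ ε' : ℝ, 0 < ε' →
      dExp θ ε' / VLB θ g' ε' ≤ dExp θ ε / VLB θ g' ε} εt) :
    (∀ τ : ℝ, 0 < τ → τ < 1 →
      ((⌈Real.log (1/τ) / dExp θ εt⌉₊ : ℝ) - 1) * VLB θ g' εt ≤ Fpay p θ g τ) ∧
    ∃ C : ℝ, 0 < C ∧ ∃ τ₀ : ℝ, 0 < τ₀ ∧ τ₀ < 1 ∧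
      ∀ τ : ℝ, 0 < τ → τ < τ₀ →
        Fpay p θ g τ ≤
          (⌈Real.log (1/τ) / dExp θ εt⌉₊ : ℝ) * VLB θ g' εt +
            C * τ * Real.log (1/τ) := by
  obtain ⟨hε, hmax⟩ := hεt.1
  have hD := dExp_pos hθ hθ1 hε
  have hV := VLB_pos hθ hθ1 hg hε
  have hF (τ : ℝ) : Fpay p θ g τ = sInf {t | FeasibleTotal p θ g τ t} := rfl
  obtain ⟨C, hC, τ₀, hτ₀, hτ₀1, hfeas⟩ := exists_feasibleTotal hp0 hp1 hθ hθ1 hg hε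
  refine ⟨fun τ hτ hτ1 => ?_, C, hC, τ₀, hτ₀, hτ₀1, fun τ hτ hττ => ?_⟩
  · obtain ⟨t, ht, -⟩ := hfeas (min τ (τ₀ / 2)) (by positivity)
      ((min_le_right _ _).trans_lt (by linarith))
    rw [hF]
    refine le_csInf ⟨t, ht.mono (min_le_left _ _)⟩ fun s hs => ?_
    have hlog : 0 < log (1 / τ) := log_pos (by rw [lt_div_iff₀ hτ]; linarith)
    refine le_trans ?_ (hs.log_mul_le hg hp0 hp1 hθ hθ1 (ρ := VLB θ g' εt / dExp θ εt)
      (by positivity) (fun ε' hε' => ?_) hτ)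
    · calc _ ≤ log (1 / τ) / dExp θ εt * VLB θ g' εt := by
            gcongr
            linarith [Nat.ceil_lt_add_one (a := log (1 / τ) / dExp θ εt) (by positivity)]
        _ = _ := by ring
    · have := hmax ε' hε'
      rw [div_le_div_iff₀ (VLB_pos hθ hθ1 hg hε') hV] at this
      rw [div_mul_eq_mul_div, div_le_iff₀ hD]
      linarith
  · obtain ⟨t, ht, hle⟩ := hfeas τ hτ hττ
    rw [hF]
    exact (csInf_le ⟨0, fun s hs => FeasibleTotal.nonneg hp0 hp1 hθ hθ1 hs⟩ ht).trans hle
end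

section
/- Analytic core of the lower bound: Suppose (K̄₁ − K̄₀)·e^ε/(e^ε+1)² = g'(ε), i.e., ε is a stationary point of the function ξ ↦ K̄₁·e^ξ/(e^ξ+1) + K̄₀/(e^ξ+1) + K̄ − g(ξ). Then the quantity −(K̄₁ − K̄₀)/(e^ε+1) + K̄₁ + K̄ (the expected payment at the ε-strategy) is at least g'(ε)·((e^ε+1)/e^ε)·((θ/(2θ−1))·(e^ε+1) − 1). -/
open Real

/-- **Analytic core of the lower bound:** if `ε` is a stationary point of
`ξ ↦ K̄₁·e^ξ/(e^ξ+1) + K̄₀/(e^ξ+1) + K̄ − g(ξ)`, i.e.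
`(K̄₁−K̄₀)·e^ε/(e^ε+1)² = g'(ε)`, then the expected payment at the `ε`-strategy,
`−(K̄₁−K̄₀)/(e^ε+1) + K̄₁ + K̄`, is at least `V_LB(ε)`. -/
theorem lower_bound_analytic_core
    (θ p ε : ℝ) (hθ : 1/2 < θ) (hθ1 : θ < 1) (hp0 : 0 < p) (hp1 : p < 1)
    (hε : 0 < ε)
    (g g' : ℝ → ℝ) (hg : ProperCost g g')
    (R11 R10 R01 R00 : ℝ)
    (hR11 : 0 ≤ R11) (hR10 : 0 ≤ R10) (hR01 : 0 ≤ R01) (hR00 : 0 ≤ R00)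
    (K1 K0 K : ℝ)
    (hK1 : K1 = (R11 - R01) * p * θ + (R10 - R00) * (1 - p) * (1 - θ))
    (hK0 : K0 = (R11 - R01) * p * (1 - θ) + (R10 - R00) * (1 - p) * θ)
    (hK : K = R01 * p + R00 * (1 - p))
    (hstat : (K1 - K0) * Real.exp ε / (Real.exp ε + 1)^2 = g' ε) :
    VLB θ g' ε ≤ -(K1 - K0) / (Real.exp ε + 1) + K1 + K := by
  have hE := Real.exp_pos ε
  have hE1 : Real.exp ε + 1 ≠ 0 := by positivity
  have hθ2 : 2 * θ - 1 ≠ 0 := by linarith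
  have hdiff : K1 - K0 = (2 * θ - 1) * ((R11 - R01) * p - (R10 - R00) * (1 - p)) := by
    rw [hK1, hK0]; ring
  have hVLB : VLB θ g' ε =
      θ * ((R11 - R01) * p - (R10 - R00) * (1 - p)) + -(K1 - K0) / (Real.exp ε + 1) := by
    rw [VLB, ← hstat, hdiff]
    field_simp
    ring
  have h10 : 0 ≤ R10 * (1 - p) := mul_nonneg hR10 (by linarith)
  have h01 : 0 ≤ R01 * p := mul_nonneg hR01 hp0.le
  rw [hVLB]
  linarith
end

section
/- Global maximizer property of the equilibrium utility function: Let ε > 0, K̄ ≥ 0, and set c = g'(ε)·(e^ε+1)²/(2e^ε). Define f : ℝ → ℝ by f(ξ) = c·e^ξ/(e^ξ+1) − c·1/(e^ξ+1) − g(|ξ|) + K̄. Then f attains its maximum over all of ℝ at ξ = ε (i.e., f(ε) ≥ f(ξ) for all ξ ∈ ℝ), and moreover f(ε) ≥ K̄. -/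
open Real

/-- A convex function on `[0, ∞)` lies above its tangent line at any point of it. -/
lemma ConvexOn.tangent_le_Ici {g : ℝ → ℝ} {m a x : ℝ} (hg : ConvexOn ℝ (Set.Ici 0) g)
    (ha : 0 ≤ a) (hm : HasDerivAt g m a) (hx : 0 ≤ x) : g a + m * (x - a) ≤ g x := by
  rcases lt_trichotomy x a with h | h | h
  · have := hg.slope_le_of_hasDerivAt (Set.mem_Ici.2 hx) (Set.mem_Ici.2 ha) h hm
    rw [slope_def_field, div_le_iff₀ (by linarith)] at this
    linarith
  · subst h
    simp
  · have := hg.le_slope_of_hasDerivAt (Set.mem_Ici.2 ha) (Set.mem_Ici.2 hx) h hm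
    rw [slope_def_field, le_div_iff₀ (by linarith)] at this
    linarith

lemma hasDerivAt_exp_sub_one_div_exp_add_one (x : ℝ) :
    HasDerivAt (fun x : ℝ => (exp x - 1) / (exp x + 1)) (2 * exp x / (exp x + 1) ^ 2) x := by
  have h := ((hasDerivAt_exp x).sub_const 1).div ((hasDerivAt_exp x).add_const 1)
    (by positivity)
  exact h.congr_deriv (by ring)

lemma concaveOn_exp_sub_one_div_exp_add_one :
    ConcaveOn ℝ (Set.Ici 0) (fun x : ℝ => (exp x - 1) / (exp x + 1)) := by
  have hd := hasDerivAt_exp_sub_one_div_exp_add_one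
  refine AntitoneOn.concaveOn_of_deriv (convex_Ici 0)
    (fun x _ => (hd x).continuousAt.continuousWithinAt)
    (fun x _ => (hd x).differentiableAt.differentiableWithinAt) ?_
  intro x hx y _ hxy
  rw [interior_Ici, Set.mem_Ioi] at hx
  rw [(hd x).deriv, (hd y).deriv, div_le_div_iff₀ (by positivity) (by positivity)]
  have h1 : 1 ≤ exp x := one_le_exp hx.le
  have h2 : exp x ≤ exp y := exp_le_exp.2 hxy
  nlinarith [mul_nonneg (sub_nonneg.2 h2)
    (sub_nonneg.2 (one_le_mul_of_one_le_of_one_le h1 (h1.trans h2)))]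


/-- **Global maximizer property of the equilibrium utility function:**
with `c = g'(ε)·(e^ε+1)²/(2e^ε)` and
`f(ξ) = c·e^ξ/(e^ξ+1) − c/(e^ξ+1) − g(|ξ|) + K̄`, the function `f` attains its maximum
over all of `ℝ` at `ξ = ε`, and `f(ε) ≥ K̄`. -/
theorem equilibrium_utility_global_max
    (g g' : ℝ → ℝ)
    (hg_conv : ConvexOn ℝ (Set.Ici 0) g)
    (hg_deriv : ∀ x ∈ Set.Ici (0:ℝ), HasDerivAt g (g' x) x)
    (hg'_cont : ContinuousOn g' (Set.Ici 0))
    (hg_mono : MonotoneOn g (Set.Ici 0))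
    (hg_nonneg : ∀ x ∈ Set.Ici (0:ℝ), 0 ≤ g x)
    (hg_zero : g 0 = 0)
    (ε K : ℝ) (hε : 0 < ε) (hK : 0 ≤ K)
    (c : ℝ) (hc : c = g' ε * (Real.exp ε + 1)^2 / (2 * Real.exp ε))
    (f : ℝ → ℝ)
    (hf : f = fun ξ =>
      c * (Real.exp ξ / (Real.exp ξ + 1)) - c * (1 / (Real.exp ξ + 1)) - g |ξ| + K) :
    (∀ ξ : ℝ, f ξ ≤ f ε) ∧ K ≤ f ε := by
  have hm : 0 ≤ g' ε := by
    have h := hg_conv.tangent_le_Ici hε.le (hg_deriv ε hε.le) le_rfl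
    have h' := hg_nonneg ε hε.le
    rw [hg_zero] at h
    by_contra! hneg
    nlinarith
  have hc0 : 0 ≤ c := by rw [hc]; positivity
  have hval : ∀ ξ, f ξ = c * ((exp ξ - 1) / (exp ξ + 1)) - g |ξ| + K := by
    intro ξ
    rw [hf]
    ring
  have hpos : ∀ ξ, 0 ≤ ξ → f ξ ≤ f ε := by
    intro ξ hξ
    have h1 := hg_conv.tangent_le_Ici hε.le (hg_deriv ε hε.le) hξ
    have h2 := concaveOn_exp_sub_one_div_exp_add_one.neg.tangent_le_Ici hε.le
      (hasDerivAt_exp_sub_one_div_exp_add_one ε).neg hξ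
    simp only [Pi.neg_apply] at h2
    have h3 := mul_le_mul_of_nonneg_left h2 hc0
    have h4 : c * (2 * exp ε / (exp ε + 1) ^ 2) = g' ε := by
      rw [hc]
      field_simp
    rw [hval, hval, abs_of_nonneg hξ, abs_of_pos hε]
    linear_combination h1 + h3 + (ξ - ε) * h4
  refine ⟨fun ξ => ?_, ?_⟩
  · rcases le_total 0 ξ with hξ | hξ
    · exact hpos ξ hξ
    · refine le_trans ?_ (hpos (-ξ) (neg_nonneg.2 hξ))
      rw [hval, hval, abs_neg]
      have h1 : (exp ξ - 1) / (exp ξ + 1) ≤ 0 :=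
        div_nonpos_of_nonpos_of_nonneg (sub_nonpos.2 (exp_le_one_iff.2 hξ)) (by positivity)
      have h2 : 0 ≤ (exp (-ξ) - 1) / (exp (-ξ) + 1) :=
        div_nonneg (sub_nonneg.2 (one_le_exp (neg_nonneg.2 hξ))) (by positivity)
      linarith [mul_le_mul_of_nonneg_left (h1.trans h2) hc0]
  · have h0 := hpos 0 le_rfl
    rw [hval 0] at h0
    simpa [hg_zero] using h0
end

section
/- Chernoff bound for the peer majority: Let 1/2 < α < 1, N ≥ 2, and let B be a Binomial(N−1, α) random variable. Define β = P(B ≥ ⌊(N−1)/2⌋ + 1), γ = 1 − C(N−1, (N−1)/2)·α^{(N−1)/2}·(1−α)^{(N−1)/2} if N−1 is even and γ = 1 if N−1 is odd, and d = (1/2)·ln(1/(4α(1−α))). Then β ≥ γ − e^{−(N−1)·d}. -/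
open Real

/-- If `0 ≤ b ≤ a`, each of the terms of `(a² + b²) ^ n` in the lower half of the binomial
expansion is at most `C(n, k) (a b) ^ n`; hence any initial part of the lower half of the
expansion is at most `(2 a b) ^ n`. -/
theorem sum_range_choose_mul_sq_pow_le {a b : ℝ} (hb : 0 ≤ b) (hab : b ≤ a) {n m : ℕ}
    (hm : m ≤ n / 2 + 1) :
    ∑ k ∈ Finset.range m, (n.choose k : ℝ) * (a ^ 2) ^ k * (b ^ 2) ^ (n - k)
      ≤ (2 * (a * b)) ^ n := by
  have ha : 0 ≤ a := hb.trans hab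
  have hterm : ∀ k ∈ Finset.range m, (n.choose k : ℝ) * (a ^ 2) ^ k * (b ^ 2) ^ (n - k)
      ≤ (n.choose k : ℝ) * (a * b) ^ n := by
    intro k hk
    rw [Finset.mem_range] at hk
    obtain ⟨j, rfl⟩ : ∃ j, n = 2 * k + j := ⟨n - 2 * k, by omega⟩
    have hj : 2 * k + j - k = k + j := by omega
    rw [hj, mul_assoc]
    refine mul_le_mul_of_nonneg_left ?_ (Nat.cast_nonneg _)
    calc (a ^ 2) ^ k * (b ^ 2) ^ (k + j) = (a * b) ^ (2 * k) * b ^ j * b ^ j := by ring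
      _ ≤ (a * b) ^ (2 * k) * a ^ j * b ^ j := by gcongr
      _ = (a * b) ^ (2 * k + j) := by ring
  calc _ ≤ ∑ k ∈ Finset.range m, (n.choose k : ℝ) * (a * b) ^ n := Finset.sum_le_sum hterm
    _ ≤ ∑ k ∈ Finset.range (n + 1), (n.choose k : ℝ) * (a * b) ^ n := by
      refine Finset.sum_le_sum_of_subset_of_nonneg ?_ fun _ _ _ => by positivity
      exact Finset.range_subset_range.2 (by omega)
    _ = (2 * (a * b)) ^ n := by
      rw [← Finset.sum_mul, ← Nat.cast_sum, Nat.sum_range_choose, mul_pow 2 (a * b)]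
      push_cast
      rfl

/-- The binomial probabilities up to `m` and those from `m + 1` on sum to one. -/
theorem sum_range_add_sum_Icc_binomial (p : ℝ) {n m : ℕ} (hm : m ≤ n) :
    ∑ k ∈ Finset.range (m + 1), (n.choose k : ℝ) * p ^ k * (1 - p) ^ (n - k)
      + ∑ k ∈ Finset.Icc (m + 1) n, (n.choose k : ℝ) * p ^ k * (1 - p) ^ (n - k) = 1 := by
  have hIcc : Finset.Icc (m + 1) n = Finset.Ico (m + 1) (n + 1) := by
    ext k
    simp only [Finset.mem_Icc, Finset.mem_Ico]
    omega
  rw [hIcc, Finset.sum_range_add_sum_Ico _ (by omega)]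
  have h := add_pow p (1 - p) n
  rw [add_sub_cancel, one_pow] at h
  exact (Finset.sum_congr rfl fun k _ => by ring).trans h.symm

/-- **Chernoff bound for the peer majority:** for `1/2 < α < 1` and `N ≥ 2`, with
`β = P(Binomial(N−1, α) ≥ ⌊(N−1)/2⌋ + 1)`,
`γ = 1 − C(N−1,(N−1)/2)·α^{(N−1)/2}(1−α)^{(N−1)/2}` if `N−1` is even and `γ = 1`
otherwise, and `d = (1/2)·ln(1/(4α(1−α)))`, we have `β ≥ γ − e^{−(N−1)·d}`. -/
theorem chernoff_peer_majority
    (α : ℝ) (hα : 1/2 < α) (hα1 : α < 1)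
    (N : ℕ) (hN : 2 ≤ N)
    (β γ d : ℝ)
    (hβ : β = ∑ k ∈ Finset.Icc ((N-1)/2 + 1) (N-1),
        ((N-1).choose k : ℝ) * α^k * (1-α)^(N-1-k))
    (hγ : γ = if (N-1) % 2 = 0 then
        1 - ((N-1).choose ((N-1)/2) : ℝ) * α^((N-1)/2) * (1-α)^((N-1)/2)
      else 1)
    (hd : d = (1/2) * Real.log (1/(4*α*(1-α)))) :
    γ - Real.exp (-((N:ℝ) - 1) * d) ≤ β := by
  obtain ⟨n, rfl⟩ : ∃ n, N = n + 1 := ⟨N - 1, by omega⟩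
  simp only [Nat.add_sub_cancel] at hβ hγ
  have hq : 0 < 1 - α := by linarith
  have ha : √α ^ 2 = α := Real.sq_sqrt (by linarith)
  have hb : √(1 - α) ^ 2 = 1 - α := Real.sq_sqrt hq.le
  have hbound : ∀ m ≤ n / 2 + 1,
      ∑ k ∈ Finset.range m, (n.choose k : ℝ) * α ^ k * (1 - α) ^ (n - k)
        ≤ (2 * (√α * √(1 - α))) ^ n := by
    intro m hm
    have h := sum_range_choose_mul_sq_pow_le (Real.sqrt_nonneg (1 - α))
      (Real.sqrt_le_sqrt (by linarith : 1 - α ≤ α)) hm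
    rwa [ha, hb] at h
  have hexp : Real.exp (-(((n + 1 : ℕ) : ℝ) - 1) * d) = (2 * (√α * √(1 - α))) ^ n := by
    have hpos : 0 < 2 * (√α * √(1 - α)) := by
      have := Real.sqrt_pos.2 hq
      have := Real.sqrt_pos.2 (by linarith : 0 < α)
      positivity
    have hsq : 4 * α * (1 - α) = (2 * (√α * √(1 - α))) ^ 2 := by
      rw [mul_pow, mul_pow, ha, hb]
      ring
    have hd' : d = -Real.log (2 * (√α * √(1 - α))) := by
      rw [hd, hsq, one_div (_ ^ 2), Real.log_inv, Real.log_pow]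
      push_cast
      ring
    rw [hd', ← Real.exp_log (pow_pos hpos n), Real.log_pow]
    congr 1
    push_cast
    ring
  have htotal := sum_range_add_sum_Icc_binomial α (Nat.div_le_self n 2)
  rw [← hβ] at htotal
  rw [hexp]
  split_ifs at hγ with hn
  · have hmid : n - n / 2 = n / 2 := by omega
    rw [Finset.sum_range_succ, hmid] at htotal
    linarith [hbound (n / 2) (by omega)]
  · linarith [hbound (n / 2 + 1) le_rfl]
end

section
/- Monotonicity of the payment function h: Let 1/2 < θ < 1, p ∈ (0,1), and γ ∈ (0,1]. Define h on the interval (γ/2, 1] by h(β) = [2β² + (4θ − 2 − 2γ)β + 2(1−θ)γ + β(1−β)·(p/(1−p)) + (γ−β)(1−(γ−β))·((1−p)/p)] / ((2β − γ)(2θ − 1)). Then h is non-increasing on (γ/2, 1]. -/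
open Real

/-- **Monotonicity of the payment function `h`:** for `1/2 < θ < 1`, `p ∈ (0,1)` and
`γ ∈ (0,1]`, the function
`h(β) = [2β² + (4θ−2−2γ)β + 2(1−θ)γ + β(1−β)·p/(1−p) + (γ−β)(1−(γ−β))·(1−p)/p] /
((2β−γ)(2θ−1))` is non-increasing on `(γ/2, 1]`. -/
theorem payment_function_antitone
    (θ p γ : ℝ) (hθ : 1/2 < θ) (hθ1 : θ < 1)
    (hp0 : 0 < p) (hp1 : p < 1) (hγ0 : 0 < γ) (hγ1 : γ ≤ 1) :
    AntitoneOn (fun β : ℝ =>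
      (2*β^2 + (4*θ - 2 - 2*γ)*β + 2*(1-θ)*γ + β*(1-β)*(p/(1-p))
        + (γ-β)*(1-(γ-β))*((1-p)/p)) / ((2*β - γ)*(2*θ - 1)))
      (Set.Ioc (γ/2) 1) := by
  intro x hx y hy hxy
  obtain ⟨hx0, -⟩ := hx
  obtain ⟨hy0, -⟩ := hy
  have hq : 0 < 1 - p := by linarith
  have hr : 0 < p / (1 - p) := by positivity
  have hs : 0 < (1 - p) / p := by positivity
  have hrs : p / (1 - p) * ((1 - p) / p) = 1 := by field_simp
  beta_reduce
  generalize p / (1 - p) = r at *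
  generalize (1 - p) / p = s at *
  have hθ' : 0 < 2 * θ - 1 := by linarith
  have hu : 0 < 2 * x - γ := by linarith
  have hv : 0 < 2 * y - γ := by linarith
  have hsum : 0 ≤ r + s - 2 := by nlinarith [sq_nonneg (r - s)]
  have hc : 0 ≤ γ * (2 - γ) * (2 + r + s) := by
    have : 0 < 2 - γ := by linarith
    positivity
  rw [div_le_div_iff₀ (by positivity) (by positivity)]
  have hxy' : 0 ≤ y - x := by linarith
  have key : 0 ≤ (2 * θ - 1) * (y - x) *
      (γ * (2 - γ) * (2 + r + s) + (r + s - 2) * ((2 * x - γ) * (2 * y - γ))) := by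
    positivity
  linarith
end

section
/- Structure of best responses, part 1 (full-participation): Let K₁, K₀, L₁, L₀ be strictly positive reals and let ḡ : [0,∞] → [0,∞] be non-decreasing with ḡ(0) = 0 and ḡ(ξ) > 0 for every ξ ∈ (0,∞]. For (p₁,p₀,q₁,q₀) in the feasible set F = {(p₁,p₀,q₁,q₀) ∈ [0,1]⁴ : p₁+q₁ ≤ 1, p₀+q₀ ≤ 1, p₁+q₁+p₀+q₀ > 0}, define the privacy level ζ(p₁,p₀,q₁,q₀) = max{|ln(p₁/p₀)|, |ln((1−p₁)/(1−p₀))|, |ln(q₁/q₀)|, |ln((1−q₁)/(1−q₀))|, |ln((1−p₁−q₁)/(1−p₀−q₀))|, |ln((p₁+q₁)/(p₀+q₀))|} with the convention 0/0 = 1 (values in [0,∞]), and the utility U(p₁,p₀,q₁,q₀) = K₁p₁ + K₀p₀ + L₁q₁ + L₀q₀ − ḡ(ζ(p₁,p₀,q₁,q₀)) (valued in [−∞,∞)). Then every maximizer of U over F satisfies p₁ + q₁ = p₀ + q₀ = 1. -/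
open Real

/-- One absolute log-likelihood-ratio term `|ln(a/b)|`, valued in `[0,∞]`, with the
convention `0/0 = 1` (so the value is `0` when `a = b = 0`, and `∞` when exactly one of
`a`, `b` is `0`). -/
noncomputable def llrA (a b : ℝ) : ENNReal :=
  if a = 0 ∧ b = 0 then 0
  else if a = 0 ∨ b = 0 then ⊤
  else ENNReal.ofReal |Real.log (a / b)|

/-- The differential-privacy level of the reporting strategy with
`P(X=1|S=s) = p_s`, `P(X=0|S=s) = q_s`, `P(X=⊥|S=s) = 1 − p_s − q_s`. -/
noncomputable def zeta4 (p₁ p₀ q₁ q₀ : ℝ) : ENNReal :=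
  llrA p₁ p₀ ⊔ llrA (1-p₁) (1-p₀) ⊔ llrA q₁ q₀ ⊔ llrA (1-q₁) (1-q₀) ⊔
    llrA (1-p₁-q₁) (1-p₀-q₀) ⊔ llrA (p₁+q₁) (p₀+q₀)

theorem llrA_self (a : ℝ) : llrA a a = 0 := by
  by_cases h : a = 0 <;> simp [llrA, h]

/-- Reassigning all abstention probability to the report `1` does not increase the privacy
level. -/
theorem zeta4_fill_le (p₁ p₀ q₁ q₀ : ℝ) :
    zeta4 (1 - q₁) (1 - q₀) q₁ q₀ ≤ zeta4 p₁ p₀ q₁ q₀ := by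
  have hq : llrA q₁ q₀ ≤ zeta4 p₁ p₀ q₁ q₀ :=
    le_sup_right.trans (le_sup_left.trans (le_sup_left.trans le_sup_left))
  have hq' : llrA (1 - q₁) (1 - q₀) ≤ zeta4 p₁ p₀ q₁ q₀ :=
    le_sup_right.trans (le_sup_left.trans le_sup_left)
  rw [zeta4]
  simp only [sub_sub_cancel, sub_self, sub_add_cancel, llrA_self]
  simp [hq, hq']

/-- **Structure of best responses, part 1 (full participation):** for strictly positive
`K₁, K₀, L₁, L₀` and a privacy cost `ḡ : [0,∞] → [0,∞]` that is non-decreasing,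
vanishes at `0` and is positive everywhere else, every maximizer of the utility
`U(p₁,p₀,q₁,q₀) = K₁p₁ + K₀p₀ + L₁q₁ + L₀q₀ − ḡ(ζ)` over the feasible set satisfies
`p₁ + q₁ = p₀ + q₀ = 1`. -/
theorem best_response_full_participation
    (K₁ K₀ L₁ L₀ : ℝ) (hK₁ : 0 < K₁) (hK₀ : 0 < K₀) (hL₁ : 0 < L₁) (hL₀ : 0 < L₀)
    (gbar : ENNReal → ENNReal) (hmono : Monotone gbar) (h0 : gbar 0 = 0)
    (hpos : ∀ ξ : ENNReal, ξ ≠ 0 → 0 < gbar ξ)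
    (F : Set (ℝ × ℝ × ℝ × ℝ))
    (hF : F = {v | v.1 ∈ Set.Icc (0:ℝ) 1 ∧ v.2.1 ∈ Set.Icc (0:ℝ) 1 ∧
      v.2.2.1 ∈ Set.Icc (0:ℝ) 1 ∧ v.2.2.2 ∈ Set.Icc (0:ℝ) 1 ∧
      v.1 + v.2.2.1 ≤ 1 ∧ v.2.1 + v.2.2.2 ≤ 1 ∧
      0 < v.1 + v.2.2.1 + v.2.1 + v.2.2.2})
    (U : ℝ × ℝ × ℝ × ℝ → EReal)
    (hU : U = fun v =>
      ((K₁ * v.1 + K₀ * v.2.1 + L₁ * v.2.2.1 + L₀ * v.2.2.2 : ℝ) : EReal) -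
        (gbar (zeta4 v.1 v.2.1 v.2.2.1 v.2.2.2) : EReal))
    (v : ℝ × ℝ × ℝ × ℝ) (hv : v ∈ F) (hmax : ∀ u ∈ F, U u ≤ U v) :
    v.1 + v.2.2.1 = 1 ∧ v.2.1 + v.2.2.2 = 1 := by
  subst hF hU
  obtain ⟨p₁, p₀, q₁, q₀⟩ := v
  obtain ⟨⟨hp₁, -⟩, ⟨hp₀, -⟩, ⟨hq₁, hq₁'⟩, ⟨hq₀, hq₀'⟩, h₁, h₀, -⟩ := hv
  dsimp only at *
  have hfin : gbar (zeta4 p₁ p₀ q₁ q₀) ≠ ⊤ := by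
    intro htop
    have h := hmax (1, 1, 0, 0) (by norm_num)
    have hz : zeta4 1 1 0 0 = 0 := by simp [zeta4, llrA_self]
    rw [hz, h0, htop, EReal.coe_ennreal_top, EReal.sub_top, EReal.coe_ennreal_zero, sub_zero] at h
    exact EReal.coe_ne_bot _ (le_bot_iff.mp h)
  have hg := hmono (zeta4_fill_le p₁ p₀ q₁ q₀)
  have hU := hmax (1 - q₁, 1 - q₀, q₁, q₀)
    ⟨⟨by linarith, by linarith⟩, ⟨by linarith, by linarith⟩, ⟨hq₁, hq₁'⟩, ⟨hq₀, hq₀'⟩,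
      by linarith, by linarith, by dsimp only; linarith⟩
  dsimp only at hU
  have hfin' := ne_top_of_le_ne_top hfin hg
  rw [← EReal.coe_toReal (x := ((gbar (zeta4 p₁ p₀ q₁ q₀) : ENNReal) : EReal)) (by simpa using hfin)
      (by simp),
    ← EReal.coe_toReal (x := ((gbar (zeta4 (1 - q₁) (1 - q₀) q₁ q₀) : ENNReal) : EReal))
      (by simpa using hfin') (by simp), ← EReal.coe_sub, ← EReal.coe_sub, EReal.coe_le_coe_iff,
    EReal.toReal_coe_ennreal, EReal.toReal_coe_ennreal] at hU
  have hg' := ENNReal.toReal_mono hfin hg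
  constructor <;> nlinarith
end
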